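/- arXiv:2404.08308 — 2 statements merged into one kernel-verified Lean document; each statement's English description precedes it below -/
import Mathlib

section
/- Let Σ be a set (alphabet), w ∈ [0,1], and let i : Bool → ℝ be given by i(true) = 0 and i(false) = 1; let d_as(u,v) := max(0, v − u). Let (o₁, δ₁) be a deterministic automaton on X and (o₂, δ₂) one on Y. Let d₁ be a 1-bounded Lawvere metric on X satisfying max( d_as(i(o₁(x)), i(o₁(x'))) , w · sup_{a∈Σ} d₁(δ₁(x,a), δ₁(x',a)) ) ≤ d₁(x,x') for all x,x' ∈ X (a simulation metric for (o₁,δ₁)), and similarly let d₂ be such a Lawvere metric on Y for (o₂,δ₂). Define the product automaton by o(x,y) := o₁(x) ∧ o₂(y), δ((x,y),a) := (δ₁(x,a), δ₂(y,a)), and define D((x,y),(x',y')) := max(d₁(x,x'), d₂(y,y')). Then D is a 1-bounded Lawvere metric on X×Y and max( d_as(i(o(x,y)), i(o(x',y'))) , w · sup_{a∈Σ} D(δ((x,y),a), δ((x',y'),a)) ) ≤ D((x,y),(x',y')) for all (x,y),(x',y') ∈ X×Y. -/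
open Set

/-- `d` is a 1-bounded Lawvere metric: `d x x = 0`, triangle inequality, values in `[0,1]`
(no symmetry required). -/
def IsLawvere1 {X : Type*} (d : X → X → ℝ) : Prop :=
  (∀ x, d x x = 0) ∧ (∀ x y z, d x z ≤ d x y + d y z) ∧ (∀ x y, d x y ∈ Icc (0:ℝ) 1)

/-- The cast `i : Bool → ℝ` with `i true = 0`, `i false = 1`. -/
def iB : Bool → ℝ := fun b => if b then 0 else 1

/-- The asymmetric distance on `[0,1]`. -/
def dAs (u v : ℝ) : ℝ := max 0 (v - u)

theorem IsLawvere1.prod_max {X Y : Type*} {d₁ : X → X → ℝ} {d₂ : Y → Y → ℝ}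
    (hd₁ : IsLawvere1 d₁) (hd₂ : IsLawvere1 d₂) :
    IsLawvere1 (fun p q : X × Y => max (d₁ p.1 q.1) (d₂ p.2 q.2)) := by
  obtain ⟨refl₁, tri₁, mem₁⟩ := hd₁
  obtain ⟨refl₂, tri₂, mem₂⟩ := hd₂
  refine ⟨fun p => by simp [refl₁, refl₂], fun p q r => max_le ?_ ?_, fun p q =>
    ⟨le_max_of_le_left (mem₁ _ _).1, max_le (mem₁ _ _).2 (mem₂ _ _).2⟩⟩
  · exact (tri₁ _ q.1 _).trans (add_le_add (le_max_left _ _) (le_max_left _ _))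
  · exact (tri₂ _ q.2 _).trans (add_le_add (le_max_right _ _) (le_max_right _ _))

theorem dAs_iB_and_le (a b a' b' : Bool) :
    dAs (iB (a && b)) (iB (a' && b')) ≤ max (dAs (iB a) (iB a')) (dAs (iB b) (iB b')) := by
  cases a <;> cases b <;> cases a' <;> cases b' <;> simp [dAs, iB]

theorem mul_sSup_range_max_le {A : Type*} {w : ℝ} (hw : 0 ≤ w) {f g : A → ℝ}
    (hf : BddAbove (range f)) (hg : BddAbove (range g)) :
    w * sSup (range fun a => max (f a) (g a)) ≤
      max (w * sSup (range f)) (w * sSup (range g)) := by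
  rw [← mul_max_of_nonneg _ _ hw]
  refine mul_le_mul_of_nonneg_left ?_ hw
  rcases isEmpty_or_nonempty A with h | h
  · simp [range_eq_empty]
  · refine csSup_le (range_nonempty _) ?_
    rintro _ ⟨a, rfl⟩
    exact max_le_max (le_csSup hf (mem_range_self a)) (le_csSup hg (mem_range_self a))

-- Note: in Mathlib, `sSup ∅ = 0` for `ℝ`, matching the convention that the
-- supremum over an empty alphabet is `0`.
theorem statement_17 {X Y A : Type*} (w : ℝ) (hw : w ∈ Icc (0:ℝ) 1)
    (o₁ : X → Bool) (δ₁ : X → A → X) (o₂ : Y → Bool) (δ₂ : Y → A → Y)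
    (d₁ : X → X → ℝ) (hd₁ : IsLawvere1 d₁)
    (d₂ : Y → Y → ℝ) (hd₂ : IsLawvere1 d₂)
    -- d₁ is a simulation metric for (o₁, δ₁)
    (hsim₁ : ∀ x x', max (dAs (iB (o₁ x)) (iB (o₁ x')))
        (w * sSup (Set.range fun a => d₁ (δ₁ x a) (δ₁ x' a))) ≤ d₁ x x')
    -- d₂ is a simulation metric for (o₂, δ₂)
    (hsim₂ : ∀ y y', max (dAs (iB (o₂ y)) (iB (o₂ y')))
        (w * sSup (Set.range fun a => d₂ (δ₂ y a) (δ₂ y' a))) ≤ d₂ y y') :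
    IsLawvere1 (fun p q : X × Y => max (d₁ p.1 q.1) (d₂ p.2 q.2)) ∧
    -- max(d₁, d₂) is a simulation metric for the product automaton
    (∀ p q : X × Y,
      max (dAs (iB (o₁ p.1 && o₂ p.2)) (iB (o₁ q.1 && o₂ q.2)))
        (w * sSup (Set.range fun a =>
          max (d₁ (δ₁ p.1 a) (δ₁ q.1 a)) (d₂ (δ₂ p.2 a) (δ₂ q.2 a)))) ≤
      max (d₁ p.1 q.1) (d₂ p.2 q.2)) := by
  refine ⟨hd₁.prod_max hd₂, fun p q => max_le ?_ ?_⟩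
  · exact (dAs_iB_and_le _ _ _ _).trans
      (max_le_max (le_of_max_le_left (hsim₁ _ _)) (le_of_max_le_left (hsim₂ _ _)))
  · have bdd₁ : BddAbove (range fun a => d₁ (δ₁ p.1 a) (δ₁ q.1 a)) :=
      ⟨1, forall_mem_range.2 fun _ => (hd₁.2.2 _ _).2⟩
    have bdd₂ : BddAbove (range fun a => d₂ (δ₂ p.2 a) (δ₂ q.2 a)) :=
      ⟨1, forall_mem_range.2 fun _ => (hd₂.2.2 _ _).2⟩
    exact (mul_sSup_range_max_le hw.1 bdd₁ bdd₂).trans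
      (max_le_max (le_of_max_le_right (hsim₁ _ _)) (le_of_max_le_right (hsim₂ _ _)))
end

section
/- Let X and Y be countable sets and let c₁ : X → Set(PMF X) and c₂ : Y → Set(PMF Y) be Markov decision processes, where PMF X denotes probability mass functions on X. Let d₁ be a 1-bounded pseudometric on X that is a bisimulation metric for c₁, i.e., H(K(d₁))(c₁(x), c₁(x')) ≤ d₁(x,x') for all x,x' ∈ X, and similarly let d₂ be a bisimulation metric for c₂. Define the composite MDP c : X×Y → Set(PMF (X×Y)) by c(x,y) := { μ⊗ν : μ ∈ c₁(x), ν ∈ c₂(y) } where (μ⊗ν)(u,v) := μ(u)·ν(v), and define D((x,y),(x',y')) := 1 − (1 − d₁(x,x'))·(1 − d₂(y,y')). Then D is a 1-bounded pseudometric on X×Y and H(K(D))(c(x,y), c(x',y')) ≤ D((x,y),(x',y')) for all (x,y),(x',y') ∈ X×Y. -/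
open Set

/-- `d` is a pseudometric: `d x x = 0`, symmetry, and the triangle inequality. -/
def IsPseudometric {X : Type*} (d : X → X → ℝ) : Prop :=
  (∀ x, d x x = 0) ∧ (∀ x y, d x y = d y x) ∧ (∀ x y z, d x z ≤ d x y + d y z)

/-- `d` is 1-bounded: all values are at most `1`. -/
def IsBounded1 {X : Type*} (d : X → X → ℝ) : Prop := ∀ x y, d x y ≤ 1

/-- `μ` is a probability mass function. -/
def IsPmf {X : Type*} (μ : X → ℝ) : Prop :=
  (∀ x, μ x ∈ Icc (0:ℝ) 1) ∧ (∑' x, μ x) = 1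

/-- The Kantorovich distance between `μ` and `ν` with respect to `d`. -/
noncomputable def kant {X : Type*} (d : X → X → ℝ) (μ ν : X → ℝ) : ℝ :=
  sSup {v : ℝ | ∃ k : X → ℝ,
    (∀ t, k t ∈ Icc (0:ℝ) 1) ∧ (∀ s t, |k s - k t| ≤ d s t) ∧
    v = |∑' x, k x * (μ x - ν x)|}

/-- Infimum with the convention that the infimum of the empty set is `1`. -/
noncomputable def inf1 (S : Set ℝ) : ℝ :=
  letI := Classical.propDecidable S.Nonempty
  if S.Nonempty then sInf S else 1

/-- The Hausdorff distance (infimum over the empty set is `1`; supremum over the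
empty set is `0`, which is Mathlib's convention for `sSup` on `ℝ`). -/
noncomputable def hausdorffD {Z : Type*} (d : Z → Z → ℝ) (A B : Set Z) : ℝ :=
  max (sSup ((fun a => inf1 ((fun b => d a b) '' B)) '' A))
      (sSup ((fun b => inf1 ((fun a => d a b) '' A)) '' B))

namespace IsPseudometric

variable {X : Type*} {d : X → X → ℝ}

theorem nonneg (hd : IsPseudometric d) (x y : X) : 0 ≤ d x y := by
  have h := hd.2.2 x y x
  rw [hd.1, hd.2.1 y x] at h
  linarith

/-- The composite `1 - (1 - d₁) (1 - d₂)` of two 1-bounded pseudometrics is a pseudometric. -/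
theorem prod {Y : Type*} {e : Y → Y → ℝ} (hd : IsPseudometric d) (hdb : IsBounded1 d)
    (he : IsPseudometric e) (heb : IsBounded1 e) :
    IsPseudometric (fun p q : X × Y => 1 - (1 - d p.1 q.1) * (1 - e p.2 q.2)) := by
  refine ⟨fun p => ?_, fun p q => ?_, fun p q r => ?_⟩
  · simp [hd.1, he.1]
  · simp only [hd.2.1 p.1 q.1, he.2.1 p.2 q.2]
  · have a := hd.2.2 p.1 q.1 r.1
    have b := he.2.2 p.2 q.2 r.2
    have a₀ := hdb p.1 r.1
    have b₀ := heb p.2 r.2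
    have a₁ := hdb p.1 q.1
    have b₁ := heb p.2 q.2
    have a₂ := hdb q.1 r.1
    have b₂ := heb q.2 r.2
    have a₃ := hd.nonneg p.1 q.1
    have b₃ := he.nonneg p.2 q.2
    have a₄ := hd.nonneg q.1 r.1
    have b₄ := he.nonneg q.2 r.2
    dsimp only
    generalize d p.1 r.1 = s at *
    generalize e p.2 r.2 = t at *
    generalize d p.1 q.1 = s₁ at *
    generalize e p.2 q.2 = t₁ at *
    generalize d q.1 r.1 = s₂ at *
    generalize e q.2 r.2 = t₂ at *
    have h₀ : 0 ≤ (1 - s) * (1 - t) := mul_nonneg (by linarith) (by linarith)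
    rcases le_total 1 (s₁ + s₂) with h | h
    · nlinarith
    rcases le_total 1 (t₁ + t₂) with h' | h'
    · nlinarith
    have : (1 - (s₁ + s₂)) * (1 - (t₁ + t₂)) ≤ (1 - s) * (1 - t) :=
      mul_le_mul (by linarith) (by linarith) (by linarith) (by linarith)
    nlinarith [mul_nonneg a₃ b₄, mul_nonneg a₄ b₃]

end IsPseudometric

theorem IsBounded1.prod {X Y : Type*} {d : X → X → ℝ} {e : Y → Y → ℝ} (hd : IsBounded1 d)
    (he : IsBounded1 e) :
    IsBounded1 (fun p q : X × Y => 1 - (1 - d p.1 q.1) * (1 - e p.2 q.2)) := fun p q => by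
  have := mul_nonneg (sub_nonneg.2 (hd p.1 q.1)) (sub_nonneg.2 (he p.2 q.2))
  dsimp only
  linarith

namespace IsPmf

variable {X Y : Type*} {μ : X → ℝ} {ν : Y → ℝ} {f : X → ℝ}

theorem nonneg (hμ : IsPmf μ) (x : X) : 0 ≤ μ x := (hμ.1 x).1

theorem summable (hμ : IsPmf μ) : Summable μ := by
  by_contra h
  have := hμ.2
  rw [tsum_eq_zero_of_not_summable h] at this
  exact zero_ne_one this

theorem nonempty (hμ : IsPmf μ) : Nonempty X := by
  by_contra h
  rw [not_nonempty_iff] at h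
  have := hμ.2
  rw [tsum_empty] at this
  exact zero_ne_one this

theorem summable_mul (hμ : IsPmf μ) (hf : ∀ x, f x ∈ Icc (0 : ℝ) 1) :
    Summable fun x => f x * μ x :=
  hμ.summable.of_nonneg_of_le (fun x => mul_nonneg (hf x).1 (hμ.nonneg x))
    fun x => mul_le_of_le_one_left (hμ.nonneg x) (hf x).2

theorem tsum_mul_mem_Icc (hμ : IsPmf μ) (hf : ∀ x, f x ∈ Icc (0 : ℝ) 1) :
    ∑' x, f x * μ x ∈ Icc (0 : ℝ) 1 :=
  ⟨tsum_nonneg fun x => mul_nonneg (hf x).1 (hμ.nonneg x),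
    ((hμ.summable_mul hf).tsum_le_tsum
      (fun x => mul_le_of_le_one_left (hμ.nonneg x) (hf x).2) hμ.summable).trans_eq hμ.2⟩

theorem hasSum_affine (hμ : IsPmf μ) (hf : ∀ x, f x ∈ Icc (0 : ℝ) 1) (a b : ℝ) :
    HasSum (fun x => (a + b * f x) * μ x) (a + b * ∑' x, f x * μ x) := by
  have h₁ := hμ.summable.hasSum.mul_left a
  rw [hμ.2, mul_one] at h₁
  have h₂ : (fun x => (a + b * f x) * μ x) = fun x => a * μ x + b * (f x * μ x) :=
    funext fun x => by ring
  rw [h₂]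
  exact h₁.add ((hμ.summable_mul hf).hasSum.mul_left b)

theorem tsum_mul_sub (hμ : IsPmf μ) {μ' : X → ℝ} (hμ' : IsPmf μ')
    (hf : ∀ x, f x ∈ Icc (0 : ℝ) 1) :
    ∑' x, f x * (μ x - μ' x) = ∑' x, f x * μ x - ∑' x, f x * μ' x := by
  simp only [mul_sub]
  exact (hμ.summable_mul hf).tsum_sub (hμ'.summable_mul hf)

theorem summable_prod (hμ : IsPmf μ) (hν : IsPmf ν) :
    Summable fun p : X × Y => μ p.1 * ν p.2 :=
  hμ.summable.mul_of_nonneg hν.summable hμ.nonneg hν.nonneg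

theorem prod (hμ : IsPmf μ) (hν : IsPmf ν) : IsPmf fun p : X × Y => μ p.1 * ν p.2 := by
  refine ⟨fun p => ⟨mul_nonneg (hμ.nonneg _) (hν.nonneg _),
    mul_le_one₀ (hμ.1 _).2 (hν.nonneg _) (hν.1 _).2⟩, ?_⟩
  rw [(hμ.summable_prod hν).tsum_prod]
  simp only [tsum_mul_left, hν.2, mul_one, hμ.2]

theorem tsum_mul_prod (hμ : IsPmf μ) (hν : IsPmf ν) {k : X × Y → ℝ}
    (hk : ∀ p, k p ∈ Icc (0 : ℝ) 1) :
    ∑' p : X × Y, k p * (μ p.1 * ν p.2) = ∑' x, (∑' y, k (x, y) * ν y) * μ x := by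
  rw [((hμ.prod hν).summable_mul hk).tsum_prod]
  refine tsum_congr fun x => ?_
  rw [← tsum_mul_right]
  exact tsum_congr fun y => by ring

end IsPmf

section Kantorovich

variable {X Y : Type*} {d : X → X → ℝ} {μ μ' : X → ℝ}

theorem kant_nonneg (d : X → X → ℝ) (μ μ' : X → ℝ) : 0 ≤ kant d μ μ' :=
  Real.sSup_nonneg fun _ ⟨_, _, _, hv⟩ => hv ▸ abs_nonneg _

theorem IsPmf.abs_tsum_mul_sub_le_one (hμ : IsPmf μ) (hμ' : IsPmf μ') {k : X → ℝ}
    (hk : ∀ x, k x ∈ Icc (0 : ℝ) 1) : |∑' x, k x * (μ x - μ' x)| ≤ 1 := by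
  rw [hμ.tsum_mul_sub hμ' hk]
  have h₁ := hμ.tsum_mul_mem_Icc hk
  have h₂ := hμ'.tsum_mul_mem_Icc hk
  rw [abs_le]
  constructor <;> linarith [h₁.1, h₁.2, h₂.1, h₂.2]

theorem kant_le_one (hμ : IsPmf μ) (hμ' : IsPmf μ') : kant d μ μ' ≤ 1 :=
  Real.sSup_le (fun _ ⟨_, hk, _, hv⟩ => hv ▸ hμ.abs_tsum_mul_sub_le_one hμ' hk) zero_le_one

theorem tsum_sub_tsum_le_kant (hμ : IsPmf μ) (hμ' : IsPmf μ') {k : X → ℝ}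
    (hk : ∀ x, k x ∈ Icc (0 : ℝ) 1) (hkd : ∀ s t, |k s - k t| ≤ d s t) :
    ∑' x, k x * μ x - ∑' x, k x * μ' x ≤ kant d μ μ' := by
  rw [← hμ.tsum_mul_sub hμ' hk]
  refine (le_abs_self _).trans (le_csSup ⟨1, ?_⟩ ⟨k, hk, hkd, rfl⟩)
  rintro _ ⟨k, hk, -, rfl⟩
  exact hμ.abs_tsum_mul_sub_le_one hμ' hk

/-- It suffices to bound the differences of expectations without absolute values, since
`1 - k` is nonexpansive whenever `k` is. -/
theorem kant_le (hμ : IsPmf μ) (hμ' : IsPmf μ') {B : ℝ} (hB : 0 ≤ B)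
    (h : ∀ k : X → ℝ, (∀ x, k x ∈ Icc (0 : ℝ) 1) → (∀ s t, k s - k t ≤ d s t) →
      ∑' x, k x * μ x - ∑' x, k x * μ' x ≤ B) :
    kant d μ μ' ≤ B := by
  refine Real.sSup_le ?_ hB
  rintro _ ⟨k, hk, hkd, rfl⟩
  rw [hμ.tsum_mul_sub hμ' hk, abs_le]
  have h₁ := h k hk fun s t => (le_abs_self _).trans (hkd s t)
  have h₂ := h (fun x => 1 + (-1) * k x)
    (fun x => ⟨by linarith [(hk x).2], by linarith [(hk x).1]⟩)
    (fun s t => by linarith [neg_abs_le (k s - k t), hkd s t])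
  rw [(hμ.hasSum_affine hk _ _).tsum_eq, (hμ'.hasSum_affine hk _ _).tsum_eq] at h₂
  constructor <;> linarith

/-- A pair `(u, v)` satisfying a relaxed Lipschitz condition can be separated by a multiple of a
single nonexpansive function. -/
theorem exists_nonexpansive_between [Nonempty X] (hd : IsPseudometric d) (hb : IsBounded1 d)
    {u v : X → ℝ} (hv : ∀ x, 0 ≤ v x) (h : ∀ x y, u x - v y ≤ d x y) :
    ∃ (k : X → ℝ) (m : ℝ), (∀ x, k x ∈ Icc (0 : ℝ) 1) ∧ (∀ s t, |k s - k t| ≤ d s t) ∧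
      ∀ x, u x ≤ k x + m ∧ k x + m ≤ v x := by
  have hbdd : ∀ x, BddBelow (range fun y => v y + d x y) := fun x =>
    ⟨0, by rintro _ ⟨y, rfl⟩; exact add_nonneg (hv y) (hd.nonneg x y)⟩
  set g : X → ℝ := fun x => ⨅ y, (v y + d x y) with hg
  have hg₀ : ∀ x, 0 ≤ g x := fun x => le_ciInf fun y => add_nonneg (hv y) (hd.nonneg x y)
  have hlip : ∀ s t, g s - g t ≤ d s t := fun s t => by
    rw [sub_le_comm]
    refine le_ciInf fun y => ?_
    have := ciInf_le (hbdd s) y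
    simp only [hg]
    linarith [hd.2.2 s t y]
  have hgb : BddBelow (range g) := ⟨0, by rintro _ ⟨x, rfl⟩; exact hg₀ x⟩
  refine ⟨fun x => g x - ⨅ x, g x, ⨅ x, g x, fun x => ⟨sub_nonneg.2 (ciInf_le hgb x), ?_⟩,
    fun s t => ?_, fun x => ⟨?_, ?_⟩⟩
  · rw [sub_le_comm]
    exact le_ciInf fun y => by linarith [hlip x y, hb x y]
  · rw [sub_sub_sub_cancel_right, abs_le]
    constructor <;> linarith [hlip s t, hlip t s, hd.2.1 s t]
  · rw [sub_add_cancel]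
    exact le_ciInf fun y => by linarith [h x y]
  · rw [sub_add_cancel]
    have := ciInf_le (hbdd x) x
    rwa [hd.1, add_zero] at this

theorem tsum_sub_tsum_le_add_mul_kant (hd : IsPseudometric d) (hb : IsBounded1 d)
    (hμ : IsPmf μ) (hμ' : IsPmf μ') {a : ℝ} (ha : a ≤ 1) {u v : X → ℝ}
    (hu : ∀ x, u x ∈ Icc (0 : ℝ) 1) (hv : ∀ x, v x ∈ Icc (0 : ℝ) 1)
    (h : ∀ x y, u x - v y ≤ a + (1 - a) * d x y) :
    ∑' x, u x * μ x - ∑' x, v x * μ' x ≤ a + (1 - a) * kant d μ μ' := by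
  rcases ha.eq_or_lt with rfl | ha
  · linarith [(hμ.tsum_mul_mem_Icc hu).2, (hμ'.tsum_mul_mem_Icc hv).1]
  have := hμ.nonempty
  have hpos : 0 < 1 - a := sub_pos.2 ha
  obtain ⟨k, m, hk, hkd, hkm⟩ := exists_nonexpansive_between hd hb
    (u := fun x => (u x - a) / (1 - a)) (v := fun x => v x / (1 - a))
    (fun x => div_nonneg (hv x).1 hpos.le) (fun x y => by
      rw [← sub_div, div_le_iff₀ hpos]
      linarith [h x y])
  have hu' : ∑' x, u x * μ x ≤ (a + (1 - a) * m) + (1 - a) * ∑' x, k x * μ x := by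
    refine hasSum_le (fun x => ?_) (hμ.summable_mul hu).hasSum (hμ.hasSum_affine hk _ _)
    have := (hkm x).1
    rw [div_le_iff₀ hpos] at this
    exact mul_le_mul_of_nonneg_right (by linarith) (hμ.nonneg x)
  have hv' : (1 - a) * m + (1 - a) * ∑' x, k x * μ' x ≤ ∑' x, v x * μ' x := by
    refine hasSum_le (fun x => ?_) (hμ'.hasSum_affine hk _ _) (hμ'.summable_mul hv).hasSum
    have := (hkm x).2
    rw [le_div_iff₀ hpos] at this
    exact mul_le_mul_of_nonneg_right (by linarith) (hμ'.nonneg x)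
  have := mul_le_mul_of_nonneg_left (tsum_sub_tsum_le_kant hμ hμ' hk hkd) hpos.le
  linarith

theorem kant_prod_le {e : Y → Y → ℝ} {ν ν' : Y → ℝ}
    (hd : IsPseudometric d) (hdb : IsBounded1 d) (he : IsPseudometric e) (heb : IsBounded1 e)
    (hμ : IsPmf μ) (hμ' : IsPmf μ') (hν : IsPmf ν) (hν' : IsPmf ν') :
    kant (fun p q : X × Y => 1 - (1 - d p.1 q.1) * (1 - e p.2 q.2))
      (fun p => μ p.1 * ν p.2) (fun p => μ' p.1 * ν' p.2) ≤
      1 - (1 - kant d μ μ') * (1 - kant e ν ν') := by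
  have hK₂ : kant e ν ν' ≤ 1 := kant_le_one hν hν'
  refine kant_le (hμ.prod hν) (hμ'.prod hν') ?_ fun k hk hkD => ?_
  · nlinarith [kant_nonneg d μ μ', kant_nonneg e ν ν']
  rw [hμ.tsum_mul_prod hν hk, hμ'.tsum_mul_prod hν' hk]
  have h := tsum_sub_tsum_le_add_mul_kant hd hdb hμ hμ' hK₂
    (fun x => hν.tsum_mul_mem_Icc fun y => hk (x, y))
    (fun x => hν'.tsum_mul_mem_Icc fun y => hk (x, y)) fun x x' => by
      have := tsum_sub_tsum_le_add_mul_kant he heb hν hν' (hdb x x')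
        (fun y => hk (x, y)) (fun y => hk (x', y)) fun y y' => by
          have := hkD (x, y) (x', y')
          dsimp only at this
          linarith
      linarith
  linarith

end Kantorovich

section Hausdorff

theorem inf1_le_one {S : Set ℝ} (h₀ : ∀ a ∈ S, 0 ≤ a) (h₁ : ∀ a ∈ S, a ≤ 1) : inf1 S ≤ 1 := by
  unfold inf1
  split_ifs with h
  · obtain ⟨a, ha⟩ := h
    exact (csInf_le ⟨0, h₀⟩ ha).trans (h₁ a ha)
  · exact le_rfl

theorem inf1_le {S : Set ℝ} (h₀ : ∀ a ∈ S, 0 ≤ a) {a : ℝ} (ha : a ∈ S) : inf1 S ≤ a := by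
  rw [inf1, if_pos ⟨a, ha⟩]
  exact csInf_le ⟨0, h₀⟩ ha

theorem one_sub_inf1_mul_le {S : Set ℝ} {s c : ℝ} (hs : 0 ≤ s) (hc : 0 ≤ c)
    (h : ∀ a ∈ S, (1 - a) * s ≤ c) : (1 - inf1 S) * s ≤ c := by
  unfold inf1
  split_ifs with hS
  · rcases hs.eq_or_lt with rfl | hs
    · simpa using hc
    rw [← le_div_iff₀ hs, sub_le_comm]
    refine le_csInf hS fun a ha => ?_
    rw [sub_le_comm, le_div_iff₀ hs]
    exact h a ha
  · simpa using hc

/-- Infima over a product set combine like the distances themselves. -/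
theorem inf1_image_prod_le {α β γ : Type*} {A : Set α} {B : Set β} {C : Set γ}
    {F : α → ℝ} {G : β → ℝ} {H : γ → ℝ} {φ : α → β → γ}
    (hF : ∀ a ∈ A, F a ∈ Icc (0 : ℝ) 1) (hG : ∀ b ∈ B, G b ∈ Icc (0 : ℝ) 1)
    (hH : ∀ c ∈ C, H c ∈ Icc (0 : ℝ) 1) (hφ : ∀ a ∈ A, ∀ b ∈ B, φ a b ∈ C)
    (h : ∀ a ∈ A, ∀ b ∈ B, H (φ a b) ≤ 1 - (1 - F a) * (1 - G b))
    {s t : ℝ} (hs : inf1 (F '' A) ≤ s) (hs₁ : s ≤ 1) (ht : inf1 (G '' B) ≤ t) (ht₁ : t ≤ 1) :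
    inf1 (H '' C) ≤ 1 - (1 - s) * (1 - t) := by
  have hH₀ : ∀ c ∈ H '' C, 0 ≤ c := forall_mem_image.2 fun c hc => (hH c hc).1
  have hI : 0 ≤ 1 - inf1 (H '' C) :=
    sub_nonneg.2 (inf1_le_one hH₀ (forall_mem_image.2 fun c hc => (hH c hc).2))
  have hG₁ : 0 ≤ 1 - inf1 (G '' B) := by
    refine sub_nonneg.2 (inf1_le_one ?_ ?_) <;> refine forall_mem_image.2 fun b hb => ?_
    exacts [(hG b hb).1, (hG b hb).2]
  have key : (1 - inf1 (F '' A)) * (1 - inf1 (G '' B)) ≤ 1 - inf1 (H '' C) := by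
    refine one_sub_inf1_mul_le hG₁ hI (forall_mem_image.2 fun a ha => ?_)
    rw [mul_comm]
    refine one_sub_inf1_mul_le (sub_nonneg.2 (hF a ha).2) hI (forall_mem_image.2 fun b hb => ?_)
    have := inf1_le hH₀ (mem_image_of_mem H (hφ a ha b hb))
    linarith [h a ha b hb]
  have : (1 - s) * (1 - t) ≤ (1 - inf1 (F '' A)) * (1 - inf1 (G '' B)) :=
    mul_le_mul (by linarith) (by linarith) (by linarith) (by linarith)
  linarith

variable {Z : Type*} {d : Z → Z → ℝ} {A B : Set Z} {r : ℝ}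

theorem hausdorffD_le (hr : 0 ≤ r) (h₁ : ∀ a ∈ A, inf1 ((fun b => d a b) '' B) ≤ r)
    (h₂ : ∀ b ∈ B, inf1 ((fun a => d a b) '' A) ≤ r) : hausdorffD d A B ≤ r :=
  max_le (Real.sSup_le (forall_mem_image.2 h₁) hr) (Real.sSup_le (forall_mem_image.2 h₂) hr)

theorem inf1_le_of_hausdorffD_le_left (hd : ∀ a ∈ A, ∀ b ∈ B, d a b ∈ Icc (0 : ℝ) 1)
    (h : hausdorffD d A B ≤ r) {a : Z} (ha : a ∈ A) : inf1 ((fun b => d a b) '' B) ≤ r := by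
  refine (le_csSup ⟨1, ?_⟩ (mem_image_of_mem _ ha)).trans ((le_max_left _ _).trans h)
  refine forall_mem_image.2 fun a ha => inf1_le_one ?_ ?_ <;>
    refine forall_mem_image.2 fun b hb => ?_
  exacts [(hd a ha b hb).1, (hd a ha b hb).2]

theorem inf1_le_of_hausdorffD_le_right (hd : ∀ a ∈ A, ∀ b ∈ B, d a b ∈ Icc (0 : ℝ) 1)
    (h : hausdorffD d A B ≤ r) {b : Z} (hb : b ∈ B) : inf1 ((fun a => d a b) '' A) ≤ r := by
  refine (le_csSup ⟨1, ?_⟩ (mem_image_of_mem _ hb)).trans ((le_max_right _ _).trans h)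
  refine forall_mem_image.2 fun b hb => inf1_le_one ?_ ?_ <;>
    refine forall_mem_image.2 fun a ha => ?_
  exacts [(hd a ha b hb).1, (hd a ha b hb).2]

end Hausdorff

theorem statement_18 {X Y : Type*} [Countable X] [Countable Y]
    (c₁ : X → Set (X → ℝ)) (c₂ : Y → Set (Y → ℝ))
    (hc₁ : ∀ x, ∀ μ ∈ c₁ x, IsPmf μ) (hc₂ : ∀ y, ∀ ν ∈ c₂ y, IsPmf ν)
    (d₁ : X → X → ℝ) (hd₁ : IsPseudometric d₁) (hb₁ : IsBounded1 d₁)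
    (d₂ : Y → Y → ℝ) (hd₂ : IsPseudometric d₂) (hb₂ : IsBounded1 d₂)
    -- d₁ is a bisimulation metric for c₁
    (hbis₁ : ∀ x x', hausdorffD (kant d₁) (c₁ x) (c₁ x') ≤ d₁ x x')
    -- d₂ is a bisimulation metric for c₂
    (hbis₂ : ∀ y y', hausdorffD (kant d₂) (c₂ y) (c₂ y') ≤ d₂ y y') :
    IsPseudometric (fun p q : X × Y => 1 - (1 - d₁ p.1 q.1) * (1 - d₂ p.2 q.2)) ∧
    IsBounded1 (fun p q : X × Y => 1 - (1 - d₁ p.1 q.1) * (1 - d₂ p.2 q.2)) ∧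
    -- D is a bisimulation metric for the composite MDP
    (∀ p q : X × Y,
      hausdorffD (kant (fun u v : X × Y => 1 - (1 - d₁ u.1 v.1) * (1 - d₂ u.2 v.2)))
        {ρ : X × Y → ℝ | ∃ μ ∈ c₁ p.1, ∃ ν ∈ c₂ p.2, ρ = fun uv : X × Y => μ uv.1 * ν uv.2}
        {ρ : X × Y → ℝ | ∃ μ ∈ c₁ q.1, ∃ ν ∈ c₂ q.2, ρ = fun uv : X × Y => μ uv.1 * ν uv.2} ≤
      1 - (1 - d₁ p.1 q.1) * (1 - d₂ p.2 q.2)) := by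
  have hD := hd₁.prod hb₁ hd₂ hb₂
  refine ⟨hD, hb₁.prod hb₂, fun p q => ?_⟩
  have hK₁ : ∀ μ ∈ c₁ p.1, ∀ μ' ∈ c₁ q.1, kant d₁ μ μ' ∈ Icc (0 : ℝ) 1 := fun μ hμ μ' hμ' =>
    ⟨kant_nonneg _ _ _, kant_le_one (hc₁ _ _ hμ) (hc₁ _ _ hμ')⟩
  have hK₂ : ∀ ν ∈ c₂ p.2, ∀ ν' ∈ c₂ q.2, kant d₂ ν ν' ∈ Icc (0 : ℝ) 1 := fun ν hν ν' hν' =>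
    ⟨kant_nonneg _ _ _, kant_le_one (hc₂ _ _ hν) (hc₂ _ _ hν')⟩
  have h₁ := hbis₁ p.1 q.1
  have h₂ := hbis₂ p.2 q.2
  refine hausdorffD_le (hD.nonneg p q) ?_ ?_
  · rintro _ ⟨μ, hμ, ν, hν, rfl⟩
    refine inf1_image_prod_le (φ := fun μ' ν' uv => μ' uv.1 * ν' uv.2) (hK₁ μ hμ) (hK₂ ν hν) ?_
      (fun μ' hμ' ν' hν' => by exact ⟨μ', hμ', ν', hν', rfl⟩)
      (fun μ' hμ' ν' hν' => kant_prod_le hd₁ hb₁ hd₂ hb₂ (hc₁ _ _ hμ) (hc₁ _ _ hμ')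
        (hc₂ _ _ hν) (hc₂ _ _ hν'))
      (inf1_le_of_hausdorffD_le_left hK₁ h₁ hμ) (hb₁ _ _)
      (inf1_le_of_hausdorffD_le_left hK₂ h₂ hν) (hb₂ _ _)
    rintro _ ⟨μ', hμ', ν', hν', rfl⟩
    exact ⟨kant_nonneg _ _ _, kant_le_one ((hc₁ _ _ hμ).prod (hc₂ _ _ hν))
      ((hc₁ _ _ hμ').prod (hc₂ _ _ hν'))⟩
  · rintro _ ⟨μ', hμ', ν', hν', rfl⟩
    refine inf1_image_prod_le (φ := fun μ ν uv => μ uv.1 * ν uv.2)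
      (fun μ hμ => hK₁ μ hμ μ' hμ') (fun ν hν => hK₂ ν hν ν' hν') ?_
      (fun μ hμ ν hν => by exact ⟨μ, hμ, ν, hν, rfl⟩)
      (fun μ hμ ν hν => kant_prod_le hd₁ hb₁ hd₂ hb₂ (hc₁ _ _ hμ) (hc₁ _ _ hμ')
        (hc₂ _ _ hν) (hc₂ _ _ hν'))
      (inf1_le_of_hausdorffD_le_right hK₁ h₁ hμ') (hb₁ _ _)
      (inf1_le_of_hausdorffD_le_right hK₂ h₂ hν') (hb₂ _ _)
    rintro _ ⟨μ, hμ, ν, hν, rfl⟩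
    exact ⟨kant_nonneg _ _ _, kant_le_one ((hc₁ _ _ hμ).prod (hc₂ _ _ hν))
      ((hc₁ _ _ hμ').prod (hc₂ _ _ hν'))⟩
end
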